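/- Let m ≥ 1 and H ≥ 1 be integers, V ∈ ℝ^S, and let (μ,ν) be an H-step lookahead policy for V. Let M : ℝ^S → ℝ^S be a linear map with operator norm ‖M‖_∞ ≤ δ_FV (with respect to the supremum norm), and suppose ‖M J^{μ,ν} − J^{μ,ν}‖_∞ ≤ δ_app. Then ‖M(T_{μ,ν}^m(T^{H−1}V)) − J*‖_∞ ≤ (α^{H−1} + (δ_FV·α^{m+H−1} + α^{H−1})·(1+α)/(1−α))·‖V − J*‖_∞ + δ_app. -/

import Mathlib

open Finset Filter Topology Matrix

noncomputable section

/-- The probability simplex over a finite subset `D` of actions: nonnegative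
weights summing to one over `D` and vanishing outside `D`. -/
def simplex {A : Type*} [Fintype A] (D : Finset A) : Set (A → ℝ) :=
  {p | (∀ a, 0 ≤ p a) ∧ (∑ a ∈ D, p a = 1) ∧ ∀ a ∉ D, p a = 0}

/-- A finite two-player zero-sum discounted Markov game. `S` is the state space,
`A` the maximizer's global action type, `B` the minimizer's global action type. -/
structure MarkovGame (S A B : Type*) [Fintype S] [Fintype A] [Fintype B] where
  U : S → Finset A
  W : S → Finset B
  U_nonempty : ∀ s, (U s).Nonempty
  W_nonempty : ∀ s, (W s).Nonempty
  P : S → A → B → S → ℝ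
  P_nonneg : ∀ s u v s', 0 ≤ P s u v s'
  P_sum : ∀ s, ∀ u ∈ U s, ∀ v ∈ W s, ∑ s', P s u v s' = 1
  g : S → A → B → ℝ
  g_nonneg : ∀ s u v, 0 ≤ g s u v
  g_le_one : ∀ s u v, g s u v ≤ 1
  α : ℝ
  α_pos : 0 < α
  α_lt_one : α < 1

namespace MarkovGame

variable {S A B : Type*} [Fintype S] [Fintype A] [Fintype B]

/-- The state-action value matrix `A_{V,s}(u,v) = g(s,u,v) + α Σ_{s'} P(s'|s,u,v) V(s')`. -/
def Aval (G : MarkovGame S A B) (V : S → ℝ) (s : S) (u : A) (v : B) : ℝ :=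
  G.g s u v + G.α * ∑ s', G.P s u v s' * V s'

/-- A policy pair assigns to each state probability vectors over the available actions. -/
def IsPolicy (G : MarkovGame S A B) (μ : S → A → ℝ) (ν : S → B → ℝ) : Prop :=
  ∀ s, μ s ∈ simplex (G.U s) ∧ ν s ∈ simplex (G.W s)

/-- The Bellman operator of a policy pair: `(T_{μ,ν}V)(s) = μ(s)ᵀ A_{V,s} ν(s)`. -/
def Tpol (G : MarkovGame S A B) (μ : S → A → ℝ) (ν : S → B → ℝ) (V : S → ℝ) : S → ℝ :=
  fun s => ∑ u ∈ G.U s, ∑ v ∈ G.W s, μ s u * ν s v * G.Aval V s u v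

/-- The Bellman optimality operator:
`(TV)(s) = max_{p ∈ Δ(U(s))} min_{q ∈ Δ(V(s))} pᵀ A_{V,s} q`. -/
def T (G : MarkovGame S A B) (V : S → ℝ) : S → ℝ :=
  fun s => sSup {x | ∃ p ∈ simplex (G.U s),
    x = sInf {y | ∃ q ∈ simplex (G.W s),
      y = ∑ u ∈ G.U s, ∑ v ∈ G.W s, p u * q v * G.Aval V s u v}}

/-- The transition matrix `P_{μ,ν}` of a policy pair. -/
def Ppol (G : MarkovGame S A B) (μ : S → A → ℝ) (ν : S → B → ℝ) : Matrix S S ℝ :=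
  Matrix.of fun s s' => ∑ u ∈ G.U s, ∑ v ∈ G.W s, μ s u * ν s v * G.P s u v s'

/-- The expected one-step reward `g_{μ,ν}` of a policy pair. -/
def gpol (G : MarkovGame S A B) (μ : S → A → ℝ) (ν : S → B → ℝ) : S → ℝ :=
  fun s => ∑ u ∈ G.U s, ∑ v ∈ G.W s, μ s u * ν s v * G.g s u v

/-- `(μ,ν)` is an `H`-step lookahead policy for `V` if it is a policy pair and
`T_{μ,ν}(T^{H-1}V) = T^H V`. -/
def IsLookahead (G : MarkovGame S A B) (H : ℕ) (μ : S → A → ℝ) (ν : S → B → ℝ)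
    (V : S → ℝ) : Prop :=
  G.IsPolicy μ ν ∧ G.Tpol μ ν (G.T^[H - 1] V) = G.T^[H] V

end MarkovGame

theorem simplex_nonempty {A : Type*} [Fintype A] {D : Finset A} (hD : D.Nonempty) :
    (simplex D).Nonempty := by
  classical
  obtain ⟨a, ha⟩ := hD
  refine ⟨Pi.single a 1, fun b => ?_, ?_, fun b hb => ?_⟩
  · by_cases h : b = a
    · subst h; simp
    · simp [h]
  · simp [ha]
  · have h : b ≠ a := fun h => hb (h ▸ ha)
    simp [h]

/-- A bilinear average of entries bounded by `c` is bounded by `c`. -/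
theorem abs_sum_simplex_le {A B : Type*} [Fintype A] [Fintype B] {D : Finset A} {E : Finset B}
    {p : A → ℝ} {q : B → ℝ} (hp : p ∈ simplex D) (hq : q ∈ simplex E) {F : A → B → ℝ} {c : ℝ}
    (hF : ∀ u ∈ D, ∀ v ∈ E, |F u v| ≤ c) :
    |∑ u ∈ D, ∑ v ∈ E, p u * q v * F u v| ≤ c := by
  calc |∑ u ∈ D, ∑ v ∈ E, p u * q v * F u v|
      ≤ ∑ u ∈ D, ∑ v ∈ E, |p u * q v * F u v| :=
        (Finset.abs_sum_le_sum_abs _ _).trans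
          (Finset.sum_le_sum fun u _ => Finset.abs_sum_le_sum_abs _ _)
    _ ≤ ∑ u ∈ D, ∑ v ∈ E, p u * q v * c := by
        refine Finset.sum_le_sum fun u hu => Finset.sum_le_sum fun v hv => ?_
        have h : 0 ≤ p u * q v := mul_nonneg (hp.1 u) (hq.1 v)
        rw [abs_mul, abs_of_nonneg h]
        exact mul_le_mul_of_nonneg_left (hF u hu v hv) h
    _ = (∑ u ∈ D, p u) * (∑ v ∈ E, q v) * c := by
        rw [Finset.sum_mul_sum]
        simp_rw [Finset.sum_mul]
    _ = c := by rw [hp.2.1, hq.2.1, one_mul, one_mul]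

/-- The max-min value is monotone up to a uniform perturbation of a bounded payoff. -/
theorem sSup_sInf_le_add {X Y : Type*} {P : Set X} {Q : Set Y} (hP : P.Nonempty)
    (hQ : Q.Nonempty) {f f' : X → Y → ℝ} {c K : ℝ}
    (hf : ∀ p ∈ P, ∀ q ∈ Q, |f p q| ≤ K) (hf' : ∀ p ∈ P, ∀ q ∈ Q, |f' p q| ≤ K)
    (h : ∀ p ∈ P, ∀ q ∈ Q, f p q ≤ f' p q + c) :
    sSup {x | ∃ p ∈ P, x = sInf {y | ∃ q ∈ Q, y = f p q}} ≤
      sSup {x | ∃ p ∈ P, x = sInf {y | ∃ q ∈ Q, y = f' p q}} + c := by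
  have hbdd : ∀ {k : X → Y → ℝ}, (∀ p ∈ P, ∀ q ∈ Q, |k p q| ≤ K) → ∀ p ∈ P,
      BddBelow {y | ∃ q ∈ Q, y = k p q} := by
    rintro k hk p hp
    refine ⟨-K, ?_⟩
    rintro y ⟨q, hq, rfl⟩
    exact (abs_le.mp (hk p hp q hq)).1
  obtain ⟨p₀, hp₀⟩ := hP
  obtain ⟨q₀, hq₀⟩ := hQ
  refine csSup_le ⟨_, p₀, hp₀, rfl⟩ ?_
  rintro x ⟨p, hp, rfl⟩
  have hle : sInf {y | ∃ q ∈ Q, y = f p q} - c ≤ sInf {y | ∃ q ∈ Q, y = f' p q} := by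
    refine le_csInf ⟨_, q₀, hq₀, rfl⟩ ?_
    rintro y ⟨q, hq, rfl⟩
    have := csInf_le (hbdd hf p hp) ⟨q, hq, rfl⟩
    linarith [h p hp q hq]
  have hsup : sInf {y | ∃ q ∈ Q, y = f' p q} ≤
      sSup {x | ∃ p ∈ P, x = sInf {y | ∃ q ∈ Q, y = f' p q}} := by
    refine le_csSup ⟨K, ?_⟩ ⟨p, hp, rfl⟩
    rintro x ⟨r, hr, rfl⟩
    exact (csInf_le (hbdd hf' r hr) ⟨q₀, hq₀, rfl⟩).trans (abs_le.mp (hf' r hr q₀ hq₀)).2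
  linarith

namespace MarkovGame

variable {S A B : Type*} [Fintype S] [Fintype A] [Fintype B]

theorem abs_Aval_sub_le (G : MarkovGame S A B) (V V' : S → ℝ) (s : S) {u : A} (hu : u ∈ G.U s)
    {v : B} (hv : v ∈ G.W s) : |G.Aval V s u v - G.Aval V' s u v| ≤ G.α * ‖V - V'‖ := by
  have heq : G.Aval V s u v - G.Aval V' s u v =
      G.α * ∑ s', G.P s u v s' * (V - V') s' := by
    simp only [Aval, Pi.sub_apply, mul_sub, Finset.sum_sub_distrib]
    ring
  rw [heq, abs_mul, abs_of_pos G.α_pos]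
  refine mul_le_mul_of_nonneg_left ?_ G.α_pos.le
  calc |∑ s', G.P s u v s' * (V - V') s'|
      ≤ ∑ s', |G.P s u v s' * (V - V') s'| := Finset.abs_sum_le_sum_abs _ _
    _ ≤ ∑ s', G.P s u v s' * ‖V - V'‖ := by
        refine Finset.sum_le_sum fun s' _ => ?_
        rw [abs_mul, abs_of_nonneg (G.P_nonneg s u v s')]
        exact mul_le_mul_of_nonneg_left (norm_le_pi_norm (V - V') s') (G.P_nonneg s u v s')
    _ = ‖V - V'‖ := by rw [← Finset.sum_mul, G.P_sum s u hu v hv, one_mul]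

theorem abs_payoff_sub_le (G : MarkovGame S A B) (V V' : S → ℝ) (s : S) {p : A → ℝ}
    (hp : p ∈ simplex (G.U s)) {q : B → ℝ} (hq : q ∈ simplex (G.W s)) :
    |(∑ u ∈ G.U s, ∑ v ∈ G.W s, p u * q v * G.Aval V s u v) -
      ∑ u ∈ G.U s, ∑ v ∈ G.W s, p u * q v * G.Aval V' s u v| ≤ G.α * ‖V - V'‖ := by
  simp_rw [← Finset.sum_sub_distrib, ← mul_sub]
  exact abs_sum_simplex_le hp hq fun u hu v hv => G.abs_Aval_sub_le V V' s hu hv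

theorem norm_Tpol_sub_le (G : MarkovGame S A B) {μ : S → A → ℝ} {ν : S → B → ℝ}
    (h : G.IsPolicy μ ν) (V V' : S → ℝ) :
    ‖G.Tpol μ ν V - G.Tpol μ ν V'‖ ≤ G.α * ‖V - V'‖ :=
  (pi_norm_le_iff_of_nonneg (mul_nonneg G.α_pos.le (norm_nonneg _))).2 fun s =>
    G.abs_payoff_sub_le V V' s (h s).1 (h s).2

theorem T_le_add (G : MarkovGame S A B) (V V' : S → ℝ) (s : S) :
    G.T V s ≤ G.T V' s + G.α * ‖V - V'‖ := by
  have habs : ∀ X : S → ℝ, ∀ u ∈ G.U s, ∀ v ∈ G.W s,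
      |G.Aval X s u v| ≤ ∑ u ∈ G.U s, ∑ v ∈ G.W s, |G.Aval X s u v| := fun X u hu v hv =>
    (Finset.single_le_sum (f := fun v => |G.Aval X s u v|) (fun _ _ => abs_nonneg _) hv).trans
      (Finset.single_le_sum (f := fun u => ∑ v ∈ G.W s, |G.Aval X s u v|)
        (fun _ _ => Finset.sum_nonneg fun _ _ => abs_nonneg _) hu)
  exact sSup_sInf_le_add (simplex_nonempty (G.U_nonempty s)) (simplex_nonempty (G.W_nonempty s))
    (fun p hp q hq => abs_sum_simplex_le hp hq fun u hu v hv =>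
      (habs V u hu v hv).trans (le_max_left _ _))
    (fun p hp q hq => abs_sum_simplex_le hp hq fun u hu v hv =>
      (habs V' u hu v hv).trans (le_max_right _ _))
    fun p hp q hq => by linarith [(abs_le.mp (G.abs_payoff_sub_le V V' s hp hq)).2]

theorem norm_T_sub_le (G : MarkovGame S A B) (V V' : S → ℝ) :
    ‖G.T V - G.T V'‖ ≤ G.α * ‖V - V'‖ := by
  refine (pi_norm_le_iff_of_nonneg (mul_nonneg G.α_pos.le (norm_nonneg _))).2 fun s => ?_
  rw [Pi.sub_apply, Real.norm_eq_abs, abs_le]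
  have h := G.T_le_add V' V s
  rw [norm_sub_rev] at h
  constructor <;> linarith [G.T_le_add V V' s]

end MarkovGame

/-- Iterates of a contraction approach a fixed point geometrically. -/
theorem norm_iterate_sub_fixed_le {E : Type*} [SeminormedAddCommGroup E] {f : E → E} {a : ℝ}
    (ha : 0 ≤ a) (hf : ∀ x y, ‖f x - f y‖ ≤ a * ‖x - y‖) {z : E} (hz : f z = z) (x : E) (n : ℕ) :
    ‖f^[n] x - z‖ ≤ a ^ n * ‖x - z‖ := by
  induction n with
  | zero => simp
  | succ n ih =>
    rw [Function.iterate_succ_apply', pow_succ']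
    calc ‖f (f^[n] x) - z‖ = ‖f (f^[n] x) - f z‖ := by rw [hz]
      _ ≤ a * ‖f^[n] x - z‖ := hf _ _
      _ ≤ a * (a ^ n * ‖x - z‖) := mul_le_mul_of_nonneg_left ih ha
      _ = a * a ^ n * ‖x - z‖ := by ring

/-- If `(μ,ν)` is an `H`-step lookahead policy for `V`, `M` is a
linear map with `‖M‖_∞ ≤ δ_FV` and `‖M J^{μ,ν} − J^{μ,ν}‖_∞ ≤ δ_app`, then
`‖M(T_{μ,ν}^m(T^{H−1}V)) − J*‖_∞ ≤
  (α^{H−1} + (δ_FV α^{m+H−1} + α^{H−1})(1+α)/(1−α))‖V − J*‖_∞ + δ_app`. -/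
theorem stmt_13 {S A B : Type*} [Fintype S] [Fintype A] [Fintype B]
    (G : MarkovGame S A B) (m H : ℕ) (hm : 1 ≤ m) (hH : 1 ≤ H) (V : S → ℝ)
    (μ : S → A → ℝ) (ν : S → B → ℝ) (hLA : G.IsLookahead H μ ν V)
    (Jmn : S → ℝ) (hfix : G.Tpol μ ν Jmn = Jmn)
    (Jstar : S → ℝ) (hJ : G.T Jstar = Jstar)
    (M : (S → ℝ) →L[ℝ] (S → ℝ)) (δFV δapp : ℝ)
    (hM : ‖M‖ ≤ δFV) (happ : ‖M Jmn - Jmn‖ ≤ δapp) :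
    ‖M ((G.Tpol μ ν)^[m] (G.T^[H - 1] V)) - Jstar‖ ≤
      (G.α ^ (H - 1) + (δFV * G.α ^ (m + H - 1) + G.α ^ (H - 1)) * (1 + G.α) / (1 - G.α)) *
        ‖V - Jstar‖ + δapp := by
  obtain ⟨hpol, hlook⟩ := hLA
  have hα := G.α_pos
  have hα' : 0 < 1 - G.α := sub_pos.2 G.α_lt_one
  set X := G.T^[H - 1] V with hX
  have hTX : G.Tpol μ ν X = G.T X := by
    rw [hlook, hX, ← Function.iterate_succ_apply' G.T, Nat.succ_eq_add_one, Nat.sub_add_cancel hH]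
  have hXstar : ‖X - Jstar‖ ≤ G.α ^ (H - 1) * ‖V - Jstar‖ :=
    norm_iterate_sub_fixed_le hα.le G.norm_T_sub_le hJ V (H - 1)
  set e := G.α ^ (H - 1) * ‖V - Jstar‖
  have hstep : ‖X - G.Tpol μ ν X‖ ≤ (1 + G.α) * e := by
    have h₁ := norm_sub_le_norm_sub_add_norm_sub X Jstar (G.T X)
    have h₂ := G.norm_T_sub_le Jstar X
    rw [hJ, norm_sub_rev Jstar X] at h₂
    rw [hTX]
    nlinarith
  have hXJ : ‖X - Jmn‖ ≤ (1 + G.α) * e / (1 - G.α) := by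
    have h₁ := norm_sub_le_norm_sub_add_norm_sub X (G.Tpol μ ν X) Jmn
    have h₂ := G.norm_Tpol_sub_le hpol X Jmn
    rw [hfix] at h₂
    rw [le_div_iff₀ hα']
    linarith
  set d := (1 + G.α) * e / (1 - G.α) with hd
  have hiter : ‖(G.Tpol μ ν)^[m] X - Jmn‖ ≤ G.α ^ m * d :=
    (norm_iterate_sub_fixed_le hα.le (G.norm_Tpol_sub_le hpol) hfix X m).trans
      (mul_le_mul_of_nonneg_left hXJ (pow_nonneg hα.le m))
  have hMiter : ‖M ((G.Tpol μ ν)^[m] X) - M Jmn‖ ≤ δFV * (G.α ^ m * d) := by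
    rw [← map_sub]
    exact M.le_of_opNorm_le_of_le hM hiter
  have hJJ : ‖Jmn - Jstar‖ ≤ d + e := by
    have h := norm_sub_le_norm_sub_add_norm_sub Jmn X Jstar
    rw [norm_sub_rev Jmn X] at h
    linarith
  have h₁ := norm_sub_le_norm_sub_add_norm_sub (M ((G.Tpol μ ν)^[m] X)) (M Jmn) Jstar
  have h₂ := norm_sub_le_norm_sub_add_norm_sub (M Jmn) Jmn Jstar
  calc ‖M ((G.Tpol μ ν)^[m] X) - Jstar‖ ≤ e + (δFV * G.α ^ m + 1) * d + δapp := by linarith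
    _ = _ := by
      rw [Nat.add_sub_assoc hH, pow_add, hd]
      ring
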